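/- arXiv:1609.01950 — 4 statements merged into one kernel-verified Lean document; each statement's English description precedes it below -/
import Mathlib

section
/- Let m ≥ 1 and r ≥ 0 be integers. Then fil''^{(r)}_m W_s(K) = (F−1)^{-1}(fil'^{(r)}_m W_s(K)). In particular (taking r = 0), fil''_m W_s(K) = (F−1)^{-1}(fil'_m W_s(K)). -/
/-!
Setting: `K` is a (complete) discrete valuation field of characteristic `p > 0`, with
normalized additive valuation `v = ord_K : K → ℤ ∪ {∞}` (normalization is expressed by
the existence of a uniformizer `π` with `v π = 1`).

`W_s(K)` is the ring of `p`-typical Witt vectors of length `s` over `K`.  Following the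
paper, a Witt vector is written `a = (a_{s-1}, …, a_0)`, where the paper's component
`a_i` is the component of standard index `s - 1 - i` (so `a_{s-1}` is the leading
component and the Verschiebung `V` sends `(a_{s-1}, …, a_0)` to `(0, a_{s-1}, …, a_0)`,
i.e. it is the standard index shift).  We realize `W_s(K)` as `TruncatedWittVector p s K`.
-/

noncomputable section

open TruncatedWittVector

variable (p : ℕ) [Fact p.Prime] (K : Type*) [Field K] [CharP K p]
variable (v : AddValuation K (WithTop ℤ))

/-- The Frobenius `F : W_s(K) → W_s(K)`, raising each component to the `p`-th power. -/
def frobW {s : ℕ} (a : TruncatedWittVector p s K) : TruncatedWittVector p s K :=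
  TruncatedWittVector.mk p fun i => a.coeff i ^ p

/-- The `k`-fold Verschiebung `V^k : W_t(K) → W_s(K)` (for `t + k = s`), shifting
components: in the paper's notation it sends `(a_{t-1}, …, a_0)` to
`(0, …, 0, a_{t-1}, …, a_0)`. -/
def VShift (k : ℕ) {t : ℕ} (s : ℕ) (a : TruncatedWittVector p t K) :
    TruncatedWittVector p s K :=
  TruncatedWittVector.mk p fun i =>
    if h : k ≤ (i : ℕ) ∧ (i : ℕ) - k < t then a.coeff ⟨(i : ℕ) - k, h.2⟩ else 0

/-- The truncation `pr_t : W_s(K) → W_t(K)`, `(a_{s-1}, …, a_0) ↦ (a_{s-1}, …, a_{s-t})`. -/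
def prW {s : ℕ} (t : ℕ) (ht : t ≤ s) (a : TruncatedWittVector p s K) :
    TruncatedWittVector p t K :=
  TruncatedWittVector.mk p fun i => a.coeff (Fin.castLE ht i)

/-- `ord_K(a) = min_{0 ≤ i ≤ s-1} p^i · ord_K(a_i)` for a Witt vector
`a = (a_{s-1}, …, a_0) ∈ W_s(K)` (the paper's component `a_i` has standard index
`s - 1 - i`, whence the weight `p ^ (s - 1 - i)` below). -/
def wittOrd {s : ℕ} (a : TruncatedWittVector p s K) : WithTop ℤ :=
  Finset.univ.inf fun i : Fin s => p ^ (s - 1 - (i : ℕ)) • v (a.coeff i)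

/-- Brylinski--Kato filtration `fil_n W_s(K) = {a ∈ W_s(K) | ord_K(a) ≥ -n}`. -/
def filW (s : ℕ) (n : ℤ) : Set (TruncatedWittVector p s K) :=
  {a | ((-n : ℤ) : WithTop ℤ) ≤ wittOrd p K v a}

/-- `fil^{(r)}_n W_s(K) = fil_{[n/p^r]} W_s(K)` (for `n ≥ 0`). -/
def filWr (s r : ℕ) (n : ℕ) : Set (TruncatedWittVector p s K) :=
  filW p K v s ((n / p ^ r : ℕ) : ℤ)

/-- Matsuda's filtration
`fil'_m W_s(K) = fil_{m-1} W_s(K) + V^{s-s'}(fil_m W_{s'}(K))`, `s' = min(ord_p m, s)`. -/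
def filW' (s m : ℕ) : Set (TruncatedWittVector p s K) :=
  {a | ∃ b ∈ filW p K v s ((m : ℤ) - 1),
      ∃ c ∈ filW p K v (min (padicValNat p m) s) (m : ℤ),
        a = b + VShift p K (s - min (padicValNat p m) s) s c}

/-- `fil'^{(r)}_m W_s(K) = fil^{(r)}_{m-1} W_s(K) + V^{s-s''}(fil^{(r)}_m W_{s''}(K))`,
where `s'' = max(0, min(ord_p m, s + r) - r)`. -/
def filW'r (s r m : ℕ) : Set (TruncatedWittVector p s K) :=
  {a | ∃ b ∈ filWr p K v s r (m - 1),
      ∃ c ∈ filWr p K v (min (padicValNat p m) (s + r) - r) r m,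
        a = b + VShift p K (s - (min (padicValNat p m) (s + r) - r)) s c}

/-- `fil''^{(r)}_m W_s(K) = fil^{(r)}_{[(m-1)/p]} W_s(K) + V^{s-s''}(fil^{(r)}_{[m/p]} W_{s''}(K))`,
where `s'' = max(0, min(ord_p m, s + r) - r)`. -/
def filW''r (s r m : ℕ) : Set (TruncatedWittVector p s K) :=
  {a | ∃ b ∈ filWr p K v s r ((m - 1) / p),
      ∃ c ∈ filWr p K v (min (padicValNat p m) (s + r) - r) r (m / p),
        a = b + VShift p K (s - (min (padicValNat p m) (s + r) - r)) s c}

/-- `fil''_m W_s(K) = fil''^{(0)}_m W_s(K)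
  = fil_{[(m-1)/p]} W_s(K) + V^{s-s'}(fil_{[m/p]} W_{s'}(K))`. -/
def filW'' (s m : ℕ) : Set (TruncatedWittVector p s K) :=
  filW''r p K v s 0 m

set_option linter.unusedSectionVars false

section Homogeneity

open MvPolynomial

variable {p}

theorem MvPolynomial.IsWeightedHomogeneous.of_C_mul {σ R : Type*} [CommRing R] [IsDomain R]
    {w : σ → ℕ} {φ : MvPolynomial σ R} {c : R} {n : ℕ} (hc : c ≠ 0)
    (h : IsWeightedHomogeneous w (C c * φ) n) : IsWeightedHomogeneous w φ n := fun d hd =>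
  h (by rw [coeff_C_mul]; exact mul_ne_zero hc hd)

/-- Evaluating the `n`-th Witt polynomial at a family whose `k`-th member is homogeneous of
weight `p ^ k` gives a polynomial all of whose terms are homogeneous of weight `p ^ n`. -/
theorem isWeightedHomogeneous_wittPolynomial_term {σ : Type*} {w : σ → ℕ}
    {f : ℕ → MvPolynomial σ ℤ} {k n : ℕ} (hk : k ≤ n)
    (hf : IsWeightedHomogeneous w (f k) (p ^ k)) :
    IsWeightedHomogeneous w (C ((p : ℤ) ^ k) * f k ^ p ^ (n - k)) (p ^ n) := by
  have h := (hf.pow (p ^ (n - k))).C_mul ((p : ℤ) ^ k)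
  rwa [smul_eq_mul, ← pow_add, Nat.sub_add_cancel hk] at h

theorem bind₁_wittPolynomial {σ : Type*} (f : ℕ → MvPolynomial σ ℤ) (n : ℕ) :
    bind₁ f (wittPolynomial p ℤ n) =
      ∑ k ∈ Finset.range (n + 1), C ((p : ℤ) ^ k) * f k ^ p ^ (n - k) := by
  rw [wittPolynomial_eq_sum_C_mul_X_pow, map_sum]
  refine Finset.sum_congr rfl fun k _ => ?_
  rw [map_mul, map_pow (bind₁ f) (X k), bind₁_X_right, algHom_C, algebraMap_eq]

theorem isWeightedHomogeneous_wittSub (n : ℕ) :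
    IsWeightedHomogeneous (fun i : Fin 2 × ℕ => p ^ i.2) (WittVector.wittSub p n) (p ^ n) := by
  induction n using Nat.strong_induction_on with
  | _ n ih =>
    have hW (i : Fin 2) : IsWeightedHomogeneous (fun i : Fin 2 × ℕ => p ^ i.2)
        (rename (Prod.mk i) (wittPolynomial p ℤ n)) (p ^ n) := by
      have : rename (Prod.mk i) (wittPolynomial p ℤ n) =
          bind₁ (fun k => X (i, k)) (wittPolynomial p ℤ n) := by
        rw [rename_eq_aeval]; rfl
      rw [this, bind₁_wittPolynomial]
      exact IsWeightedHomogeneous.sum _ _ _ fun k hk =>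
        isWeightedHomogeneous_wittPolynomial_term (f := fun k => X (i, k))
          (Finset.mem_range_succ_iff.1 hk) (isWeightedHomogeneous_X ℤ _ (i, k))
    have key := wittStructureInt_prop p (X 0 - X 1 : MvPolynomial (Fin 2) ℤ) n
    rw [bind₁_wittPolynomial, Finset.sum_range_succ, map_sub, bind₁_X_right, bind₁_X_right,
      Nat.sub_self, pow_zero, pow_one, ← eq_sub_iff_add_eq'] at key
    refine .of_C_mul (c := (p : ℤ) ^ n)
      (pow_ne_zero _ (mod_cast (Fact.out : p.Prime).ne_zero)) ?_
    rw [WittVector.wittSub, key]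
    exact ((hW 0).sub (hW 1)).sub <| IsWeightedHomogeneous.sum _ _ _ fun k hk =>
      isWeightedHomogeneous_wittPolynomial_term (Finset.mem_range.1 hk).le
        (ih k (Finset.mem_range.1 hk))

end Homogeneity

section ValuationBounds

variable {K v}

theorem AddValuation.intCast_nonneg (n : ℤ) : 0 ≤ v (n : K) := by
  induction n using Int.induction_on with
  | zero => simp
  | succ n ih => push_cast at ih ⊢; exact v.map_le_add ih v.map_one.ge
  | pred n ih => push_cast at ih ⊢; exact v.map_le_sub ih v.map_one.ge

theorem AddValuation.map_finset_prod {ι : Type*} (t : Finset ι) (f : ι → K) :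
    v (∏ i ∈ t, f i) = ∑ i ∈ t, v (f i) := by
  classical
  induction t using Finset.induction_on with
  | empty => simp
  | insert i t hi ih => rw [Finset.prod_insert hi, Finset.sum_insert hi, v.map_mul, ih]

theorem AddValuation.neg_le_nsmul_map_zero (N c : ℕ) :
    ((-(c : ℤ) : ℤ) : WithTop ℤ) ≤ N • v 0 :=
  le_trans (by norm_cast; omega) (nsmul_nonneg (v.map_zero.ge.trans' le_top) N)

theorem AddValuation.le_nsmul_map_sum {ι : Type*} {t : Finset ι} {f : ι → K} {g : ℤ} {N : ℕ}
    (hN : N ≠ 0) (h : ∀ i ∈ t, (g : WithTop ℤ) ≤ N • v (f i)) :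
    (g : WithTop ℤ) ≤ N • v (∑ i ∈ t, f i) := by
  refine Finset.sum_induction f (fun x => (g : WithTop ℤ) ≤ N • v x) (fun x y hx hy => ?_) ?_ h
  · rcases v.map_add' x y with h | h
    · exact hx.trans (nsmul_le_nsmul_right h N)
    · exact hy.trans (nsmul_le_nsmul_right h N)
  · obtain ⟨N, rfl⟩ := Nat.exists_eq_succ_of_ne_zero hN
    simp [succ_nsmul]

theorem WithTop.le_of_nsmul_le_nsmul {N : ℕ} (hN : N ≠ 0) {g : ℤ} {x : WithTop ℤ}
    (h : N • (g : WithTop ℤ) ≤ N • x) : (g : WithTop ℤ) ≤ x := by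
  induction x with
  | top => exact le_top
  | coe x =>
    norm_cast at h ⊢
    exact le_of_nsmul_le_nsmul_right hN h

theorem WithTop.neg_div_le_nsmul_iff {N q c : ℕ} (hq : 0 < q) (hN : N ≠ 0) {x : WithTop ℤ} :
    ((-((c / q : ℕ) : ℤ) : ℤ) : WithTop ℤ) ≤ N • x ↔
      ((-(c : ℤ) : ℤ) : WithTop ℤ) ≤ N • (q • x) := by
  induction x with
  | top =>
    obtain ⟨N, rfl⟩ := Nat.exists_eq_succ_of_ne_zero hN
    obtain ⟨q, rfl⟩ := Nat.exists_eq_succ_of_ne_zero hq.ne'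
    simp [succ_nsmul]
  | coe x =>
    norm_cast
    push_cast [nsmul_eq_mul]
    rw [neg_le, Int.le_ediv_iff_mul_le (by exact_mod_cast hq), neg_mul, neg_le, mul_assoc,
      mul_comm x]

theorem WithTop.neg_le_nsmul_of_neg_le_nsmul_nsmul {N q c : ℕ} (hq : 0 < q) {x : WithTop ℤ}
    (h : ((-(c : ℤ) : ℤ) : WithTop ℤ) ≤ N • (q • x)) :
    ((-(c : ℤ) : ℤ) : WithTop ℤ) ≤ N • x := by
  rcases le_total 0 x with hx | hx
  · exact le_trans (by norm_cast; omega) (nsmul_nonneg hx N)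
  · induction x with
    | top => simp at hx
    | coe x =>
      norm_cast at h hx ⊢
      simp only [nsmul_eq_mul] at h ⊢
      have : (N : ℤ) * (q * x) ≤ N * x :=
        mul_le_mul_of_nonneg_left (by nlinarith) (by positivity)
      omega

theorem AddValuation.neg_le_nsmul_of_artinSchreier {N q c : ℕ} (hq : 1 < q) {x : K}
    (h : ((-(c : ℤ) : ℤ) : WithTop ℤ) ≤ N • v (x ^ q - x)) :
    ((-(c : ℤ) : ℤ) : WithTop ℤ) ≤ N • (q • v x) := by
  rcases le_or_gt 0 (v x) with hx | hx
  · exact le_trans (by norm_cast; omega) (nsmul_nonneg (nsmul_nonneg hx q) N)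
  · rwa [v.map_sub_eq_of_lt_left, v.map_pow] at h
    rw [v.map_pow]
    generalize v x = y at hx
    induction y with
    | top => simp at hx
    | coe y =>
      norm_cast at hx ⊢
      simp only [nsmul_eq_mul]
      nlinarith

end ValuationBounds

section CoeffBound

variable {p K v}

theorem neg_le_nsmul_coeff_sub {s : ℕ} {C : ℕ → ℕ} (hC : Monotone C) {a b : WittVector p K}
    (ha : ∀ k < s, ((-(C k : ℤ) : ℤ) : WithTop ℤ) ≤ p ^ (s - 1 - k) • v (a.coeff k))
    (hb : ∀ k < s, ((-(C k : ℤ) : ℤ) : WithTop ℤ) ≤ p ^ (s - 1 - k) • v (b.coeff k))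
    {n : ℕ} (hn : n < s) :
    ((-(C n : ℤ) : ℤ) : WithTop ℤ) ≤ p ^ (s - 1 - n) • v ((a - b).coeff n) := by
  have hp : p.Prime := Fact.out
  rw [WittVector.sub_coeff, WittVector.peval, MvPolynomial.aeval_def, MvPolynomial.eval₂_eq]
  refine v.le_nsmul_map_sum (pow_ne_zero _ hp.ne_zero) fun d hd => ?_
  have hw := isWeightedHomogeneous_wittSub (p := p) n (MvPolynomial.mem_support_iff.1 hd)
  rw [Finsupp.weight_apply, Finsupp.sum] at hw
  rw [v.map_mul, AddValuation.map_finset_prod]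
  refine le_trans ?_ (nsmul_le_nsmul_right
    (le_add_of_nonneg_left (v.intCast_nonneg (MvPolynomial.coeff d (WittVector.wittSub p n)))) _)
  refine WithTop.le_of_nsmul_le_nsmul (pow_ne_zero n hp.ne_zero) ?_
  rw [← mul_nsmul', ← pow_add, add_comm n, Nat.sub_add_cancel (by omega), ← Finset.sum_nsmul, ← hw,
    Finset.sum_smul]
  refine Finset.sum_le_sum fun i hi => ?_
  have hin : i.2 ≤ n := by
    by_contra! h
    have h1 := Finset.single_le_sum (f := fun i => d i • p ^ i.2) (fun _ _ => Nat.zero_le _) hi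
    have h2 := Nat.pow_lt_pow_right hp.one_lt h
    have h3 : 0 < d i := Nat.pos_of_ne_zero (Finsupp.mem_support_iff.1 hi)
    exact h2.not_ge ((Nat.le_mul_of_pos_left _ h3).trans (h1.trans_eq hw))
  have hx : ((-(C n : ℤ) : ℤ) : WithTop ℤ) ≤
      p ^ (s - 1 - i.2) • v (Function.uncurry ![a.coeff, b.coeff] i) := by
    have hle : ((-(C n : ℤ) : ℤ) : WithTop ℤ) ≤ ((-(C i.2 : ℤ) : ℤ) : WithTop ℤ) := by
      have := hC hin
      norm_cast
      omega
    obtain ⟨j, k⟩ := i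
    fin_cases j
    · exact hle.trans (ha _ (hin.trans_lt hn))
    · exact hle.trans (hb _ (hin.trans_lt hn))
  rw [v.map_pow]
  refine (nsmul_le_nsmul_right hx _).trans_eq ?_
  rw [← mul_nsmul', ← mul_nsmul', smul_eq_mul, mul_assoc, ← pow_add,
    Nat.add_sub_of_le (by omega), mul_comm]

variable (p v) in
/-- The subgroup of Witt vectors whose `k`-th coefficients `x`, for `k < s`, satisfy
`p ^ (s - 1 - k) * v x ≥ -C k`. -/
def coeffBound (s : ℕ) {C : ℕ → ℕ} (hC : Monotone C) : AddSubgroup (WittVector p K) :=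
  AddSubgroup.ofSub
    {a | ∀ k < s, ((-(C k : ℤ) : ℤ) : WithTop ℤ) ≤ p ^ (s - 1 - k) • v (a.coeff k)}
    ⟨0, fun k _ => by
      rw [WittVector.zero_coeff]
      exact v.neg_le_nsmul_map_zero _ _⟩
    fun a ha b hb k hk => by
      rw [← sub_eq_add_neg]
      exact neg_le_nsmul_coeff_sub hC ha hb hk

theorem mem_coeffBound {s : ℕ} {C : ℕ → ℕ} {hC : Monotone C} {a : WittVector p K} :
    a ∈ coeffBound p v s hC ↔
      ∀ k < s, ((-(C k : ℤ) : ℤ) : WithTop ℤ) ≤ p ^ (s - 1 - k) • v (a.coeff k) := Iff.rfl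

theorem WittVector.coeff_sub_of_forall_lt_eq_zero {a b : WittVector p K} {n : ℕ}
    (ha : ∀ k < n, a.coeff k = 0) (hb : ∀ k < n, b.coeff k = 0) :
    (a - b).coeff n = a.coeff n - b.coeff n := by
  have h (z : WittVector p K) : (WittVector.verschiebung^[n] z).coeff n = z.coeff 0 := by
    simpa using WittVector.iterate_verschiebung_coeff z n 0
  rw [WittVector.eq_iterate_verschiebung ha, WittVector.eq_iterate_verschiebung hb,
    ← iterate_map_sub, h, h, h]
  exact map_sub (WittVector.constantCoeff (p := p)) _ _

theorem frobenius_sub_self_mem_coeffBound_iff {s : ℕ} {C : ℕ → ℕ} (hC : Monotone C)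
    {a : WittVector p K} :
    WittVector.frobenius a - a ∈ coeffBound p v s hC ↔
      ∀ k < s, ((-(C k : ℤ) : ℤ) : WithTop ℤ) ≤ p ^ (s - 1 - k) • (p • v (a.coeff k)) := by
  have hp : p.Prime := Fact.out
  have of_bound {b : WittVector p K}
      (hb : ∀ k < s, ((-(C k : ℤ) : ℤ) : WithTop ℤ) ≤ p ^ (s - 1 - k) • (p • v (b.coeff k))) :
      WittVector.frobenius b - b ∈ coeffBound p v s hC := by
    refine sub_mem (fun k hk => ?_) fun k hk =>
      WithTop.neg_le_nsmul_of_neg_le_nsmul_nsmul hp.pos (hb k hk)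
    rw [WittVector.coeff_frobenius_charP, v.map_pow]
    exact hb k hk
  refine ⟨fun h n => ?_, of_bound⟩
  induction n using Nat.strong_induction_on with
  | _ n ih =>
    intro hn
    have hx : WittVector.frobenius (WittVector.init n a) - WittVector.init n a ∈
        coeffBound p v s hC := by
      refine of_bound fun k hk => ?_
      rw [WittVector.init, WittVector.select, WittVector.coeff_mk]
      split_ifs with hkn
      · exact ih k hkn hk
      · rw [← mul_nsmul']
        exact v.neg_le_nsmul_map_zero _ _
    have hy : WittVector.frobenius (WittVector.tail n a) - WittVector.tail n a ∈
        coeffBound p v s hC := by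
      have := sub_mem h hx
      nth_rewrite 1 2 [← WittVector.init_add_tail a n] at this
      rw [map_add] at this
      convert this using 1
      abel
    have h0 : ∀ k < n, (WittVector.tail n a).coeff k = 0 := fun k hk => by
      rw [WittVector.tail, WittVector.select, WittVector.coeff_mk, if_neg (by omega)]
    have hn' := hy n hn
    rw [WittVector.coeff_sub_of_forall_lt_eq_zero (fun k hk => by
      rw [WittVector.coeff_frobenius_charP, h0 k hk, zero_pow hp.ne_zero]) h0,
      WittVector.coeff_frobenius_charP, WittVector.tail, WittVector.select, WittVector.coeff_mk,
      if_pos le_rfl] at hn'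
    exact AddValuation.neg_le_nsmul_of_artinSchreier hp.one_lt hn'

end CoeffBound

section Truncated

variable {p K v}

theorem mem_filW_iff {s : ℕ} {n : ℤ} {a : TruncatedWittVector p s K} :
    a ∈ filW p K v s n ↔
      ∀ i : Fin s, ((-n : ℤ) : WithTop ℤ) ≤ p ^ (s - 1 - (i : ℕ)) • v (a.coeff i) := by
  simp [filW, wittOrd, Finset.le_inf_iff]

theorem monotone_ite_lt {A B : ℕ} (hAB : A ≤ B) (j : ℕ) :
    Monotone fun k => if k < j then A else B := by
  intro k l hkl
  dsimp only
  split_ifs <;> omega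

/-- Adding a shifted Witt vector of length `t` with order at least `-B` to one with order at
least `-A` relaxes the bound exactly on the last `t` coefficients. -/
theorem exists_add_VShift_iff {s t A B : ℕ} (ht : t ≤ s) (hAB : A ≤ B)
    {a : WittVector p K} :
    (∃ b ∈ filW p K v s A, ∃ c ∈ filW p K v t B,
        WittVector.truncate s a = b + VShift p K (s - t) s c) ↔
      a ∈ coeffBound p v s (monotone_ite_lt hAB (s - t)) := by
  constructor
  · rintro ⟨b, hb, c, hc, h⟩
    rw [mem_filW_iff] at hb hc
    have hsum : b.out + (VShift p K (s - t) s c).out ∈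
        coeffBound p v s (monotone_ite_lt hAB (s - t)) := by
      refine add_mem (fun k hk => ?_) fun k hk => ?_
      · have hle : ((-((if k < s - t then A else B : ℕ) : ℤ) : ℤ) : WithTop ℤ) ≤
            ((-(A : ℤ) : ℤ) : WithTop ℤ) := by
          split_ifs <;> (norm_cast; try omega)
        rw [TruncatedWittVector.coeff_out _ ⟨k, hk⟩]
        exact hle.trans (hb ⟨k, hk⟩)
      · rw [TruncatedWittVector.coeff_out _ ⟨k, hk⟩, VShift, TruncatedWittVector.coeff_mk]
        by_cases h1 : s - t ≤ k
        · have h2 : k - (s - t) < t := by omega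
          have := hc ⟨k - (s - t), h2⟩
          rw [show t - 1 - (k - (s - t)) = s - 1 - k by omega] at this
          simpa only [if_neg h1.not_gt, dif_pos (And.intro h1 h2)] using this
        · rw [dif_neg (fun h2 => h1 h2.1)]
          exact v.neg_le_nsmul_map_zero _ _
    have htr : WittVector.truncate s a =
        WittVector.truncate s (b.out + (VShift p K (s - t) s c).out) := by
      rw [h, map_add]
      congr 1 <;> ext i <;> rw [WittVector.coeff_truncate, TruncatedWittVector.coeff_out]
    intro k hk
    have hk' := congrArg (TruncatedWittVector.coeff ⟨k, hk⟩) htr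
    rw [WittVector.coeff_truncate, WittVector.coeff_truncate] at hk'
    exact hk' ▸ hsum k hk
  · intro ha
    refine ⟨WittVector.truncate s (WittVector.init (s - t) a), mem_filW_iff.2 fun i => ?_,
      TruncatedWittVector.mk p fun i => a.coeff (s - t + i), mem_filW_iff.2 fun i => ?_, ?_⟩
    · rw [WittVector.coeff_truncate, WittVector.init, WittVector.select, WittVector.coeff_mk]
      split_ifs with h
      · simpa only [if_pos h] using ha i i.2
      · exact v.neg_le_nsmul_map_zero _ _
    · have := ha (s - t + i) (by omega)
      simp only [if_neg (show ¬s - t + (i : ℕ) < s - t by omega)] at this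
      rw [show s - 1 - (s - t + (i : ℕ)) = t - 1 - i by omega] at this
      rwa [TruncatedWittVector.coeff_mk]
    · nth_rewrite 1 [← WittVector.init_add_tail a (s - t)]
      rw [map_add]
      congr 1
      ext i
      rw [WittVector.coeff_truncate, WittVector.tail, WittVector.select, WittVector.coeff_mk,
        VShift, TruncatedWittVector.coeff_mk]
      by_cases h : s - t ≤ i
      · rw [if_pos h, dif_pos ⟨h, by omega⟩, TruncatedWittVector.coeff_mk,
          Nat.add_sub_cancel' h]
      · rw [if_neg h, dif_neg (by omega)]

theorem frobW_truncate_sub {s : ℕ} (a : WittVector p K) :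
    frobW p K (WittVector.truncate s a) - WittVector.truncate s a =
      WittVector.truncate s (WittVector.frobenius a - a) := by
  rw [map_sub]
  congr 1
  ext i
  rw [frobW, TruncatedWittVector.coeff_mk, WittVector.coeff_truncate, WittVector.coeff_truncate,
    WittVector.coeff_frobenius_charP]

/-- Division of the bounds by `p` computes preimages under `F - 1`. -/
theorem preimage_frobW_sub {s t A B : ℕ} (ht : t ≤ s) (hAB : A ≤ B) :
    (fun a : TruncatedWittVector p s K => frobW p K a - a) ⁻¹'
        {a | ∃ b ∈ filW p K v s A, ∃ c ∈ filW p K v t B, a = b + VShift p K (s - t) s c} =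
      {a | ∃ b ∈ filW p K v s (A / p : ℕ), ∃ c ∈ filW p K v t (B / p : ℕ),
        a = b + VShift p K (s - t) s c} := by
  have hp : p.Prime := Fact.out
  ext a
  obtain ⟨a, rfl⟩ := WittVector.truncate_surjective p s K a
  rw [Set.mem_preimage, frobW_truncate_sub, Set.mem_ofPred_eq, Set.mem_ofPred_eq,
    exists_add_VShift_iff ht hAB, exists_add_VShift_iff ht (Nat.div_le_div_right hAB),
    frobenius_sub_self_mem_coeffBound_iff, mem_coeffBound]
  refine forall₂_congr fun k _ => ?_
  rw [← WithTop.neg_div_le_nsmul_iff hp.pos (pow_ne_zero _ hp.ne_zero), apply_ite (· / p)]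

end Truncated

/-- Lemma 1.18 (v) of the paper.  For `m ≥ 1` and `r ≥ 0`,
`fil''^{(r)}_m W_s(K) = (F-1)⁻¹(fil'^{(r)}_m W_s(K))`; in particular (`r = 0`)
`fil''_m W_s(K) = (F-1)⁻¹(fil'_m W_s(K))`. -/
theorem statement8 (hv : ∃ π : K, v π = 1) (s r m : ℕ) (hm : 1 ≤ m) :
    ((fun a : TruncatedWittVector p s K => frobW p K a - a) ⁻¹' (filW'r p K v s r m)
        = filW''r p K v s r m) ∧
    ((fun a : TruncatedWittVector p s K => frobW p K a - a) ⁻¹' (filW' p K v s m)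
        = filW'' p K v s m) := by
  have hr (r : ℕ) : (fun a : TruncatedWittVector p s K => frobW p K a - a) ⁻¹'
      (filW'r p K v s r m) = filW''r p K v s r m := by
    have := preimage_frobW_sub (p := p) (K := K) (v := v)
      (show min (padicValNat p m) (s + r) - r ≤ s by omega)
      (Nat.div_le_div_right (c := p ^ r) (show m - 1 ≤ m by omega))
    rw [Nat.div_div_eq_div_mul, Nat.div_div_eq_div_mul, mul_comm, ← Nat.div_div_eq_div_mul,
      ← Nat.div_div_eq_div_mul] at this
    exact this
  refine ⟨hr r, ?_⟩
  have h0 : filW' p K v s m = filW'r p K v s 0 m := by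
    simp [filW', filW'r, filWr, hm]
  rw [h0, hr 0, filW'']
end
end

section
/- Let m ≥ 2 and 0 ≤ t ≤ s be integers. Then the t-fold Verschiebung V^t and the truncation pr_t induce exact sequences of abelian groups 0 → fil'_m W_{s-t}(K)/fil'_{m-1} W_{s-t}(K) → fil'_m W_s(K)/fil'_{m-1} W_s(K) → fil'^{(s-t)}_m W_t(K)/fil'^{(s-t)}_{m-1} W_t(K) → 0 and 0 → fil''_m W_{s-t}(K)/fil''_{m-1} W_{s-t}(K) → fil''_m W_s(K)/fil''_{m-1} W_s(K) → fil''^{(s-t)}_m W_t(K)/fil''^{(s-t)}_{m-1} W_t(K) → 0. -/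
/-!
Setting: `K` is a (complete) discrete valuation field of characteristic `p > 0`, with
normalized additive valuation `v = ord_K : K → ℤ ∪ {∞}` (normalization is expressed by
the existence of a uniformizer `π` with `v π = 1`).

`W_s(K)` is the ring of `p`-typical Witt vectors of length `s` over `K`.  Following the
paper, a Witt vector is written `a = (a_{s-1}, …, a_0)`, where the paper's component
`a_i` is the component of standard index `s - 1 - i` (so `a_{s-1}` is the leading
component and the Verschiebung `V` sends `(a_{s-1}, …, a_0)` to `(0, a_{s-1}, …, a_0)`,
i.e. it is the standard index shift).  We realize `W_s(K)` as `TruncatedWittVector p s K`.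
-/

noncomputable section

open TruncatedWittVector

variable (p : ℕ) [Fact p.Prime] (K : Type*) [Field K] [CharP K p]
variable (v : AddValuation K (WithTop ℤ))

set_option linter.unusedSectionVars false

namespace WittVector

variable {p K}

theorem coeff_teichmuller_mul (r : K) (x : WittVector p K) (n : ℕ) :
    (teichmuller p r * x).coeff n = r ^ p ^ n * x.coeff n := by
  induction n generalizing r x with
  | zero => simp [mul_coeff_zero]
  | succ n ih =>
    have hx : x = teichmuller p (x.coeff 0) + verschiebung (x.shift 1) := by
      ext i
      rw [coeff_add_of_disjoint]
      · cases i with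
        | zero => simp
        | succ i =>
          simp [teichmuller_coeff_pos, shift_coeff, add_comm]
      · intro i
        cases i with
        | zero => right; simp
        | succ i => left; simp [teichmuller_coeff_pos]
    have hr : frobenius (teichmuller p r) = teichmuller p (r ^ p) := by
      ext i
      rw [coeff_frobenius_charP]
      cases i with
      | zero => rw [teichmuller_coeff_zero, teichmuller_coeff_zero]
      | succ i =>
        rw [teichmuller_coeff_pos _ _ _ i.succ_pos, teichmuller_coeff_pos _ _ _ i.succ_pos,
          zero_pow (Fact.out : p.Prime).ne_zero]
    have key : teichmuller p r * x =
        teichmuller p (r * x.coeff 0) + verschiebung (teichmuller p (r ^ p) * x.shift 1) := by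
      conv_lhs => rw [hx]
      rw [mul_add, ← map_mul, ← hr, mul_comm (frobenius _), verschiebung_mul_frobenius,
        mul_comm (verschiebung _)]
    rw [key, coeff_add_of_disjoint]
    · rw [teichmuller_coeff_pos _ _ _ n.succ_pos, zero_add, verschiebung_coeff_succ, ih,
        shift_coeff, ← pow_mul, ← pow_succ', add_comm 1 n]
    · intro i
      cases i with
      | zero => right; simp
      | succ i => exact Or.inl (teichmuller_coeff_pos _ _ _ i.succ_pos)

theorem coeff_add_mem_of_forall_mem {R : Type*} [CommRing R] (O : Subring R)
    {x y : WittVector p R}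
    (hx : ∀ i, x.coeff i ∈ O) (hy : ∀ i, y.coeff i ∈ O) (i : ℕ) : (x + y).coeff i ∈ O := by
  have lift : ∀ z : WittVector p R, (∀ i, z.coeff i ∈ O) →
      ∃ z' : WittVector p O, map O.subtype z' = z := fun z hz =>
    ⟨WittVector.mk p fun i => ⟨z.coeff i, hz i⟩, by ext i; simp [map_coeff]⟩
  obtain ⟨x', rfl⟩ := lift x hx
  obtain ⟨y', rfl⟩ := lift y hy
  rw [← map_add, map_coeff]
  exact Subtype.prop _

end WittVector

variable {K} in
/-- The valuation ring of an additive valuation, as a subring. -/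
def AddValuation.nonnegSubring : Subring K where
  carrier := {x | 0 ≤ v x}
  mul_mem' {x y} hx hy := by
    change 0 ≤ v (x * y)
    rw [v.map_mul]
    exact add_nonneg hx hy
  one_mem' := by
    change 0 ≤ v 1
    rw [v.map_one]
  add_mem' hx hy := v.map_le_add hx hy
  zero_mem' := by
    change 0 ≤ v 0
    rw [v.map_zero]
    exact le_top
  neg_mem' {x} hx := by
    change 0 ≤ v (-x)
    rw [v.map_neg]
    exact hx

variable {p K v}

theorem WithTop.nsmul_top_of_ne_zero {α : Type*} [AddMonoid α] {n : ℕ} (hn : n ≠ 0) :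
    n • (⊤ : WithTop α) = ⊤ := by
  obtain ⟨k, rfl⟩ := Nat.exists_eq_succ_of_ne_zero hn
  rw [succ_nsmul, WithTop.add_top]

theorem nonneg_pow_mul_pow_iff {π : K} (hπ : v π = 1) (n i N : ℕ) (x : K) :
    0 ≤ v ((π ^ n) ^ p ^ i * x ^ p ^ N) ↔
      ∀ z : ℤ, v x = z → -((n : ℤ) * p ^ i) ≤ p ^ N * z := by
  have hp : p ^ N ≠ 0 := pow_ne_zero _ (Fact.out : p.Prime).ne_zero
  rw [v.map_mul, v.map_pow, v.map_pow, v.map_pow, hπ]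
  cases hx : v x with
  | top => simp [WithTop.nsmul_top_of_ne_zero hp]
  | coe w =>
    have h1 : (1 : WithTop ℤ) = ((1 : ℤ) : WithTop ℤ) := rfl
    have h0 : (0 : WithTop ℤ) = ((0 : ℤ) : WithTop ℤ) := rfl
    rw [h1, h0, ← WithTop.coe_nsmul, ← WithTop.coe_nsmul, ← WithTop.coe_nsmul, ← WithTop.coe_add,
      WithTop.coe_le_coe]
    simp only [WithTop.coe_inj, forall_eq', nsmul_eq_mul, Nat.cast_pow, mul_one]
    rw [mul_comm (n : ℤ)]
    constructor <;> intro h <;> linarith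

/-- The Witt vectors whose coefficients satisfy a pole bound of Brylinski--Kato type are closed
under addition. -/
theorem WittVector.neg_le_coeff_add {π : K} (hπ : v π = 1) (n N : ℕ) {x y : WittVector p K}
    (hx : ∀ i, ∀ z : ℤ, v (x.coeff i) = z → -((n : ℤ) * p ^ i) ≤ p ^ N * z)
    (hy : ∀ i, ∀ z : ℤ, v (y.coeff i) = z → -((n : ℤ) * p ^ i) ≤ p ^ N * z) (i : ℕ) :
    ∀ z : ℤ, v ((x + y).coeff i) = z → -((n : ℤ) * p ^ i) ≤ p ^ N * z := by
  have hcoeff : ∀ (w : WittVector p K) (i : ℕ),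
      (teichmuller p (π ^ n) * frobenius^[N] w).coeff i =
        (π ^ n) ^ p ^ i * w.coeff i ^ p ^ N := fun w i => by
    rw [coeff_teichmuller_mul, iterate_frobenius_coeff]
  rw [← nonneg_pow_mul_pow_iff hπ, ← hcoeff, iterate_map_add, mul_add]
  refine coeff_add_mem_of_forall_mem v.nonnegSubring (fun i => ?_) (fun i => ?_) i
  · rw [hcoeff]
    exact (nonneg_pow_mul_pow_iff hπ n i N _).2 (hx i)
  · rw [hcoeff]
    exact (nonneg_pow_mul_pow_iff hπ n i N _).2 (hy i)

theorem neg_le_pow_smul_iff (n : ℤ) (k : ℕ) (w : WithTop ℤ) :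
    ((-n : ℤ) : WithTop ℤ) ≤ p ^ k • w ↔ ∀ z : ℤ, w = z → -n ≤ p ^ k * z := by
  have hp : p ^ k ≠ 0 := pow_ne_zero _ (Fact.out : p.Prime).ne_zero
  cases w with
  | top => simp [WithTop.nsmul_top_of_ne_zero hp]
  | coe w =>
    rw [← WithTop.coe_nsmul, WithTop.coe_le_coe]
    simp only [WithTop.coe_inj, forall_eq', nsmul_eq_mul, Nat.cast_pow]

variable (p K v)

/-- Witt vectors whose `i`-th coefficient has valuation at least `-B j / p ^ j`, where
`j = s + r - 1 - i`. -/
def wittBox (s r : ℕ) (B : ℕ → ℤ) : Set (TruncatedWittVector p s K) :=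
  {a | ∀ i : Fin s, ∀ z : ℤ, v (a.coeff i) = z →
    -B (s + r - 1 - i) ≤ p ^ (s + r - 1 - (i : ℕ)) * z}

/-- The common shape of the non-log filtrations: `fil^{(r)}_n W_s + V^{s-s''} fil^{(r)}_{n'} W_{s''}`
with `s'' = max(0, min(e, s + r) - r)`. -/
def matsudaFil (s r e n n' : ℕ) : Set (TruncatedWittVector p s K) :=
  {a | ∃ b ∈ filWr p K v s r n, ∃ c ∈ filWr p K v (min e (s + r) - r) r n',
    a = b + VShift p K (s - (min e (s + r) - r)) s c}

variable {p K v}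

theorem filWr_eq_wittBox (s r n : ℕ) : filWr p K v s r n = wittBox p K v s r fun _ => n := by
  ext a
  simp only [filWr, filW, wittOrd, wittBox, Set.mem_ofPred_eq, Finset.le_inf_iff, Finset.mem_univ,
    true_implies, neg_le_pow_smul_iff]
  refine forall_congr' fun i => forall_congr' fun z => imp_congr_right fun _ => ?_
  have hi : s + r - 1 - (i : ℕ) = (s - 1 - i) + r := by have := i.isLt; omega
  have hp : (0 : ℤ) < p ^ r := pow_pos (by exact_mod_cast (Fact.out : p.Prime).pos) r
  rw [hi, pow_add]
  push_cast
  rw [neg_le, Int.le_ediv_iff_mul_le hp, neg_le]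
  constructor <;> intro h <;> linarith

theorem add_mem_wittBox_const (hv : ∃ π : K, v π = 1) {s r n : ℕ}
    {a b : TruncatedWittVector p s K} (ha : a ∈ wittBox p K v s r fun _ => n)
    (hb : b ∈ wittBox p K v s r fun _ => n) : a + b ∈ wittBox p K v s r fun _ => n := by
  obtain ⟨π, hπ⟩ := hv
  have hp : (0 : ℤ) < p := by exact_mod_cast (Fact.out : p.Prime).pos
  have hsplit : ∀ i < s, (p : ℤ) ^ (s + r - 1) = p ^ (s + r - 1 - i) * p ^ i := fun i hi => by
    rw [← pow_add]; congr 1; omega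
  have hout : ∀ c ∈ wittBox p K v s r fun _ => (n : ℤ), ∀ i, ∀ z : ℤ, v (c.out.coeff i) = z →
      -((n : ℤ) * p ^ i) ≤ p ^ (s + r - 1) * z := fun c hc i z hz => by
    by_cases hi : i < s
    · have h := hc ⟨i, hi⟩ z (by rw [← hz, ← TruncatedWittVector.coeff_out])
      rw [hsplit i hi]
      have := mul_le_mul_of_nonneg_right h (pow_pos hp i).le
      simp only at this
      linarith
    · simp [out, hi] at hz
  have hab : a + b = WittVector.truncateFun s (a.out + b.out) := by
    rw [WittVector.truncateFun_add, truncateFun_out, truncateFun_out]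
  intro i z hz
  rw [hab, WittVector.coeff_truncateFun] at hz
  have h := WittVector.neg_le_coeff_add hπ n (s + r - 1) (hout a ha) (hout b hb) i z hz
  rw [hsplit i i.isLt] at h
  refine le_of_mul_le_mul_right ?_ (pow_pos hp i)
  linarith

theorem wittBox_mono {s r : ℕ} {B B' : ℕ → ℤ} (h : ∀ j, B j ≤ B' j) :
    wittBox p K v s r B ⊆ wittBox p K v s r B' := fun _ ha i z hz =>
  (neg_le_neg (h _)).trans (ha i z hz)

theorem coeff_VShift_of_lt {k t s : ℕ} (x : TruncatedWittVector p t K) {i : Fin s}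
    (hi : (i : ℕ) < k) : (VShift p K k s x).coeff i = 0 := by
  simp [VShift, coeff_mk, hi.not_ge]

theorem coeff_VShift_of_eq_add {k t s : ℕ} (x : TruncatedWittVector p t K) (i : Fin s)
    (j : Fin t) (hij : (i : ℕ) = k + j) : (VShift p K k s x).coeff i = x.coeff j := by
  have hj := j.isLt
  rw [VShift, coeff_mk, dif_pos ⟨by omega, by omega⟩]
  congr 1
  ext
  simp [hij]

theorem VShift_mem_wittBox_iff {k t s r : ℕ} (h : k + t = s) {B : ℕ → ℤ}
    (x : TruncatedWittVector p t K) :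
    VShift p K k s x ∈ wittBox p K v s r B ↔ x ∈ wittBox p K v t r B := by
  have hw : ∀ (i : Fin s) (j : Fin t), (i : ℕ) = k + j →
      s + r - 1 - (i : ℕ) = t + r - 1 - j := fun i j hij => by omega
  constructor
  · intro hx j z hz
    have hj := j.isLt
    have := hx ⟨k + j, by omega⟩ z (by rw [← hz, coeff_VShift_of_eq_add x _ j rfl])
    rwa [hw _ j rfl] at this
  · intro hx i z hz
    have hi := i.isLt
    rcases lt_or_ge (i : ℕ) k with hik | hik
    · rw [coeff_VShift_of_lt x hik, v.map_zero] at hz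
      exact absurd hz WithTop.top_ne_coe
    · have hij : (i : ℕ) = k + (⟨i - k, by omega⟩ : Fin t) := by simp; omega
      rw [coeff_VShift_of_eq_add x i _ hij] at hz
      rw [hw i _ hij]
      exact hx _ z hz

theorem prW_eq_truncate {s t : ℕ} (ht : t ≤ s) (a : TruncatedWittVector p s K) :
    prW p K t ht a = truncate ht a := by
  ext i
  rw [coeff_truncate, prW, coeff_mk]

theorem prW_VShift {k t s : ℕ} (hk : k ≤ s) (x : TruncatedWittVector p t K) :
    prW p K k hk (VShift p K k s x) = 0 := by
  ext i
  rw [prW, coeff_mk, coeff_VShift_of_lt x (i := Fin.castLE hk i) i.isLt, coeff_zero]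

theorem coeff_add_VShift_of_lt {k t s : ℕ} (hk : k ≤ s) (b : TruncatedWittVector p s K)
    (x : TruncatedWittVector p t K) {i : Fin s} (hi : (i : ℕ) < k) :
    (b + VShift p K k s x).coeff i = b.coeff i := by
  have h : truncate hk (b + VShift p K k s x) = truncate hk b := by
    rw [map_add, ← prW_eq_truncate hk (VShift p K k s x), prW_VShift, add_zero]
  have := congrArg (TruncatedWittVector.coeff ⟨i, hi⟩) h
  rwa [coeff_truncate, coeff_truncate] at this

/-- The Witt vector obtained by replacing the coefficients of index at least `k` by zero. -/
def headW {s : ℕ} (k : ℕ) (a : TruncatedWittVector p s K) : TruncatedWittVector p s K :=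
  TruncatedWittVector.mk p fun i => if (i : ℕ) < k then a.coeff i else 0

theorem exists_eq_headW_add_VShift {k t s : ℕ} (h : k + t = s) (a : TruncatedWittVector p s K) :
    ∃ x : TruncatedWittVector p t K, (∀ j : Fin t, x.coeff j = a.coeff ⟨k + j, by omega⟩) ∧
      a = headW k a + VShift p K k s x := by
  refine ⟨TruncatedWittVector.mk p fun j => a.coeff ⟨k + j, by omega⟩,
    fun j => coeff_mk _ _, ?_⟩
  set x : TruncatedWittVector p t K :=
    TruncatedWittVector.mk p fun j => a.coeff ⟨k + j, by omega⟩
  have hsum : headW k a + VShift p K k s x =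
      WittVector.truncateFun s ((headW k a).out + (VShift p K k s x).out) := by
    rw [WittVector.truncateFun_add, truncateFun_out, truncateFun_out]
  rw [hsum]
  ext i
  rw [WittVector.coeff_truncateFun, WittVector.coeff_add_of_disjoint, coeff_out, coeff_out]
  · have hi := i.isLt
    rcases lt_or_ge (i : ℕ) k with hik | hik
    · simp [headW, coeff_mk, hik, coeff_VShift_of_lt x hik]
    · have hij : (i : ℕ) = k + (⟨i - k, by omega⟩ : Fin t) := by simp; omega
      rw [coeff_VShift_of_eq_add x i _ hij, headW, coeff_mk, if_neg hik.not_gt, zero_add, coeff_mk]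
      congr 1
      ext
      exact hij
  · intro n
    by_cases hn : n < s
    · have e := fun c : TruncatedWittVector p s K => coeff_out c ⟨n, hn⟩
      simp only at e
      rw [e, e]
      rcases lt_or_ge n k with hnk | hnk
      · exact Or.inr (coeff_VShift_of_lt x hnk)
      · exact Or.inl (by rw [headW, coeff_mk, if_neg hnk.not_gt])
    · left
      simp [out, hn]

theorem headW_mem_wittBox {s k r : ℕ} {B : ℕ → ℤ} {a : TruncatedWittVector p s K}
    (h : ∀ i : Fin s, (i : ℕ) < k → ∀ z : ℤ, v (a.coeff i) = z →
      -B (s + r - 1 - i) ≤ p ^ (s + r - 1 - (i : ℕ)) * z) :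
    headW k a ∈ wittBox p K v s r B := by
  intro i z hz
  rw [headW, coeff_mk] at hz
  split_ifs at hz with hik
  · exact h i hik z hz
  · rw [v.map_zero] at hz
    exact absurd hz WithTop.top_ne_coe

theorem matsudaFil_eq_wittBox (hv : ∃ π : K, v π = 1) (s r e : ℕ) {n n' : ℕ} (hn : n ≤ n') :
    matsudaFil p K v s r e n n' =
      wittBox p K v s r fun j => if j < e then (n' : ℤ) else n := by
  have hk : s - (min e (s + r) - r) + (min e (s + r) - r) = s := by omega
  have hn' : (n : ℤ) ≤ n' := by exact_mod_cast hn
  ext a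
  constructor
  · rintro ⟨b, hb, c, hc, rfl⟩
    rw [filWr_eq_wittBox] at hb hc
    have hsum := add_mem_wittBox_const hv (wittBox_mono (fun _ => hn') hb)
      ((VShift_mem_wittBox_iff hk c).2 hc)
    intro i z hz
    have hi := i.isLt
    by_cases hie : s + r - 1 - (i : ℕ) < e
    · simp only [hie, if_true]
      exact hsum i z hz
    · simp only [hie, if_false]
      rw [coeff_add_VShift_of_lt (by omega) b c (by omega)] at hz
      exact hb i z hz
  · intro ha
    obtain ⟨c, hc, hac⟩ := exists_eq_headW_add_VShift hk a
    refine ⟨_, ?_, c, ?_, hac⟩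
    · rw [filWr_eq_wittBox]
      refine headW_mem_wittBox fun i hi z hz => ?_
      have := ha i z hz
      simp only at this
      rwa [if_neg (by omega)] at this
    · rw [filWr_eq_wittBox]
      intro j z hz
      rw [hc] at hz
      have hj := j.isLt
      have := ha _ z hz
      simp only at this
      rw [if_pos (by omega)] at this
      convert this using 3
      omega

theorem filW'_eq_matsudaFil {s m : ℕ} (hm : 1 ≤ m) :
    filW' p K v s m = matsudaFil p K v s 0 (padicValNat p m) (m - 1) m := by
  simp only [filW', matsudaFil, filWr, pow_zero, Nat.div_one, Nat.cast_sub hm, Nat.cast_one,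
    Nat.add_zero, Nat.sub_zero]

theorem prW_mem_wittBox {s t : ℕ} (ht : t ≤ s) {B : ℕ → ℤ} {y : TruncatedWittVector p s K}
    (hy : y ∈ wittBox p K v s 0 B) : prW p K t ht y ∈ wittBox p K v t (s - t) B := by
  intro i z hz
  rw [prW, coeff_mk] at hz
  have := hy _ z hz
  have e : t + (s - t) - 1 - (i : ℕ) = s + 0 - 1 - i := by omega
  rw [e]
  exact this

theorem headW_mem_wittBox_of_prW {s t : ℕ} (ht : t ≤ s) {B : ℕ → ℤ}
    {y : TruncatedWittVector p s K} (hy : prW p K t ht y ∈ wittBox p K v t (s - t) B) :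
    headW t y ∈ wittBox p K v s 0 B := by
  refine headW_mem_wittBox fun i hi z hz => ?_
  have := hy ⟨i, hi⟩ z (by rw [← hz, prW, coeff_mk]; rfl)
  have e : t + (s - t) - 1 - (i : ℕ) = s + 0 - 1 - i := by omega
  rwa [e] at this

theorem prW_mem_wittBox_iff_exists {s t : ℕ} (ht : t ≤ s) {B B' : ℕ → ℤ}
    {y : TruncatedWittVector p s K} (hy : y ∈ wittBox p K v s 0 B) :
    prW p K t ht y ∈ wittBox p K v t (s - t) B' ↔
      ∃ x ∈ wittBox p K v (s - t) 0 B, y - VShift p K t s x ∈ wittBox p K v s 0 B' := by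
  constructor
  · intro h
    obtain ⟨x, hx, hyx⟩ := exists_eq_headW_add_VShift (Nat.add_sub_cancel' ht) y
    refine ⟨x, fun j z hz => ?_, ?_⟩
    · rw [hx] at hz
      have := hy _ z hz
      have e : s - t + 0 - 1 - (j : ℕ) = s + 0 - 1 - (t + j) := by omega
      rw [e]
      exact this
    · rw [sub_eq_of_eq_add hyx]
      exact headW_mem_wittBox_of_prW ht h
  · rintro ⟨x, -, hx⟩
    have := prW_mem_wittBox ht hx
    rwa [prW_eq_truncate, map_sub, ← prW_eq_truncate ht (VShift p K t s x), prW_VShift, sub_zero,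
      ← prW_eq_truncate] at this

theorem exists_prW_eq {s t : ℕ} (ht : t ≤ s) {B : ℕ → ℤ} {z : TruncatedWittVector p t K}
    (hz : z ∈ wittBox p K v t (s - t) B) : ∃ y ∈ wittBox p K v s 0 B, prW p K t ht y = z := by
  obtain ⟨y, hy⟩ := truncate_surjective ht z
  have hyz : prW p K t ht y = z := by rw [prW_eq_truncate, hy]
  refine ⟨headW t y, headW_mem_wittBox_of_prW ht (hyz ▸ hz), ?_⟩
  rw [← hyz]
  ext i
  simp [prW, headW, coeff_mk]

theorem wittBox_exact {s t : ℕ} (ht : t ≤ s) (B B' : ℕ → ℤ) :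
    (∀ x ∈ wittBox p K v (s - t) 0 B, VShift p K t s x ∈ wittBox p K v s 0 B) ∧
    (∀ x ∈ wittBox p K v (s - t) 0 B', VShift p K t s x ∈ wittBox p K v s 0 B') ∧
    (∀ y ∈ wittBox p K v s 0 B, prW p K t ht y ∈ wittBox p K v t (s - t) B) ∧
    (∀ x ∈ wittBox p K v (s - t) 0 B,
        VShift p K t s x ∈ wittBox p K v s 0 B' → x ∈ wittBox p K v (s - t) 0 B') ∧
    (∀ y ∈ wittBox p K v s 0 B,
        (prW p K t ht y ∈ wittBox p K v t (s - t) B' ↔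
          ∃ x ∈ wittBox p K v (s - t) 0 B, y - VShift p K t s x ∈ wittBox p K v s 0 B')) ∧
    (∀ z ∈ wittBox p K v t (s - t) B, ∃ y ∈ wittBox p K v s 0 B, prW p K t ht y = z) :=
  have h := Nat.add_sub_cancel' ht
  ⟨fun x => (VShift_mem_wittBox_iff h x).2, fun x => (VShift_mem_wittBox_iff h x).2,
    fun _ => prW_mem_wittBox ht, fun x _ => (VShift_mem_wittBox_iff h x).1,
    fun _ => prW_mem_wittBox_iff_exists ht, fun _ => exists_prW_eq ht⟩

variable (p K v)

/-- Corollary 1.19 of the paper.  Let `m ≥ 2` and `0 ≤ t ≤ s`.  Then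
`V^t` and `pr_t` induce exact sequences of abelian groups
`0 → fil'_m W_{s-t}/fil'_{m-1} W_{s-t} → fil'_m W_s/fil'_{m-1} W_s →
fil'^{(s-t)}_m W_t/fil'^{(s-t)}_{m-1} W_t → 0` and likewise for `fil''`
(expressed elementwise: the maps preserve the filtrations, the induced `V^t` is
injective, the sequence is exact at the middle, and `pr_t` is surjective). -/
theorem statement9 (hv : ∃ π : K, v π = 1) (s t m : ℕ) (ht : t ≤ s) (hm : 2 ≤ m) :
    (∀ x ∈ filW' p K v (s - t) m, VShift p K t s x ∈ filW' p K v s m) ∧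
    (∀ x ∈ filW' p K v (s - t) (m - 1), VShift p K t s x ∈ filW' p K v s (m - 1)) ∧
    (∀ y ∈ filW' p K v s m, prW p K t ht y ∈ filW'r p K v t (s - t) m) ∧
    (∀ x ∈ filW' p K v (s - t) m,
        VShift p K t s x ∈ filW' p K v s (m - 1) → x ∈ filW' p K v (s - t) (m - 1)) ∧
    (∀ y ∈ filW' p K v s m,
        (prW p K t ht y ∈ filW'r p K v t (s - t) (m - 1) ↔
          ∃ x ∈ filW' p K v (s - t) m,
            y - VShift p K t s x ∈ filW' p K v s (m - 1))) ∧
    (∀ z ∈ filW'r p K v t (s - t) m, ∃ y ∈ filW' p K v s m, prW p K t ht y = z) ∧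
    (∀ x ∈ filW'' p K v (s - t) m, VShift p K t s x ∈ filW'' p K v s m) ∧
    (∀ x ∈ filW'' p K v (s - t) (m - 1), VShift p K t s x ∈ filW'' p K v s (m - 1)) ∧
    (∀ y ∈ filW'' p K v s m, prW p K t ht y ∈ filW''r p K v t (s - t) m) ∧
    (∀ x ∈ filW'' p K v (s - t) m,
        VShift p K t s x ∈ filW'' p K v s (m - 1) → x ∈ filW'' p K v (s - t) (m - 1)) ∧
    (∀ y ∈ filW'' p K v s m,
        (prW p K t ht y ∈ filW''r p K v t (s - t) (m - 1) ↔
          ∃ x ∈ filW'' p K v (s - t) m,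
            y - VShift p K t s x ∈ filW'' p K v s (m - 1))) ∧
    (∀ z ∈ filW''r p K v t (s - t) m, ∃ y ∈ filW'' p K v s m, prW p K t ht y = z) := by
  have hfil : ∀ s n, 1 ≤ n → filW' p K v s n = wittBox p K v s 0 fun j =>
      if j < padicValNat p n then (n : ℤ) else (n - 1 : ℕ) := fun s n hn => by
    rw [filW'_eq_matsudaFil hn, matsudaFil_eq_wittBox hv _ _ _ (Nat.sub_le n 1)]
  have hfil₁ : ∀ s r n, filW'r p K v s r n = wittBox p K v s r fun j =>
      if j < padicValNat p n then (n : ℤ) else (n - 1 : ℕ) := fun s r n =>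
    matsudaFil_eq_wittBox hv s r (padicValNat p n) (Nat.sub_le n 1)
  have hfil₂ : ∀ s r n, filW''r p K v s r n = wittBox p K v s r fun j =>
      if j < padicValNat p n then ((n / p : ℕ) : ℤ) else ((n - 1) / p : ℕ) := fun s r n =>
    matsudaFil_eq_wittBox hv s r (padicValNat p n) (Nat.div_le_div_right (Nat.sub_le n 1))
  simp only [filW'', hfil _ m (by omega), hfil _ (m - 1) (by omega), hfil₁, hfil₂]
  obtain ⟨h₁, h₂, h₃, h₄, h₅, h₆⟩ := wittBox_exact (p := p) (K := K) (v := v) ht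
    (fun j => if j < padicValNat p m then (m : ℤ) else (m - 1 : ℕ))
    (fun j => if j < padicValNat p (m - 1) then ((m - 1 : ℕ) : ℤ) else (m - 1 - 1 : ℕ))
  exact ⟨h₁, h₂, h₃, h₄, h₅, h₆, wittBox_exact ht _ _⟩
end
end

section
/- Let F, G, H be abelian groups, f : F → G a surjective homomorphism, and g : G → H a homomorphism. Let r ≥ 1 be an integer, let Γ = ℕ^r be partially ordered componentwise, and let 1_i ∈ Γ denote the i-th standard basis vector. Let (fil_n F)_{n∈Γ} and (fil_n H)_{n∈Γ} be families of subgroups that are increasing for the product order and satisfy ⋃_{n∈Γ} fil_n F = F and ⋃_{n∈Γ} fil_n H = H, and put fil_n G = f(fil_n F) for each n ∈ Γ. Assume that g(fil_n G) ⊆ fil_n H for every n ∈ Γ, and that for every n ∈ Γ and every 1 ≤ i ≤ r, any element of fil_{n+1_i} G whose image under g lies in fil_n H already belongs to fil_n G (i.e. the induced maps fil_{n+1_i}G/fil_nG → fil_{n+1_i}H/fil_nH are injective). Then fil_n G = g^{-1}(fil_n H) for every n ∈ Γ. -/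
/-- If a property of `ι → ℕ` can be lowered by one standard basis vector at every index above `n`,
then it holds at `n` as soon as it holds at some index above `n`. -/
theorem Pi.nat_descend {ι : Type*} [Fintype ι] [DecidableEq ι] {P : (ι → ℕ) → Prop} {n : ι → ℕ}
    (step : ∀ m, n ≤ m → ∀ i, P (m + Pi.single i 1) → P m) (k : ι → ℕ) (hk : P (n + k)) : P n := by
  induction hs : ∑ i, k i generalizing k with
  | zero =>
    have hk0 : k = 0 := funext fun i => by simpa using Finset.sum_eq_zero_iff.mp hs i
    simpa [hk0] using hk
  | succ s ih =>
    obtain ⟨i, -, hi⟩ := Finset.exists_ne_zero_of_sum_ne_zero (hs.trans_ne s.succ_ne_zero)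
    have hle : Pi.single i 1 ≤ k := by
      intro j
      obtain rfl | hj := eq_or_ne j i
      · simpa using Nat.one_le_iff_ne_zero.mpr hi
      · simp [hj]
    obtain ⟨l, rfl⟩ := exists_add_of_le hle
    refine ih l (step (n + l) le_self_add i ?_) ?_
    · rwa [add_assoc, add_comm l]
    · simp only [Pi.add_apply, Finset.sum_add_distrib, Finset.sum_pi_single', Finset.mem_univ,
        if_true] at hs
      omega

/-- Lemma 1.27 of the paper, abelian-group form.
Let `f : F → G` be a surjective homomorphism of abelian groups and `g : G → H` a
homomorphism.  Let `Γ = ℕ^r` (`r ≥ 1`) with the product order, and let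
`(fil_n F)_{n ∈ Γ}` and `(fil_n H)_{n ∈ Γ}` be increasing exhaustive families of
subgroups; put `fil_n G = f(fil_n F)`.  If `g(fil_n G) ⊆ fil_n H` for all `n` and the
induced maps `fil_{n+1ᵢ}G/fil_nG → fil_{n+1ᵢ}H/fil_nH` are injective for all `n ∈ Γ`
and `1 ≤ i ≤ r`, then `fil_n G = g⁻¹(fil_n H)` for every `n ∈ Γ`. -/
theorem statement15 {F G H : Type*} [AddCommGroup F] [AddCommGroup G] [AddCommGroup H]
    (f : F →+ G) (g : G →+ H) (hf : Function.Surjective f)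
    (r : ℕ) (hr : 1 ≤ r)
    (filF : (Fin r → ℕ) → AddSubgroup F) (filH : (Fin r → ℕ) → AddSubgroup H)
    (hmonoF : Monotone filF) (hmonoH : Monotone filH)
    (hexhF : ∀ x : F, ∃ n, x ∈ filF n) (hexhH : ∀ x : H, ∃ n, x ∈ filH n)
    (hg : ∀ n, ((filF n).map f).map g ≤ filH n)
    (hinj : ∀ (n : Fin r → ℕ) (i : Fin r), ∀ x ∈ (filF (n + Pi.single i 1)).map f,
        g x ∈ filH n → x ∈ (filF n).map f) :
    ∀ n, (filF n).map f = (filH n).comap g := by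
  intro n
  refine le_antisymm (AddSubgroup.map_le_iff_le_comap.mp (hg n)) fun x hx => ?_
  obtain ⟨y, rfl⟩ := hf x
  obtain ⟨m, hm⟩ := hexhF y
  exact Pi.nat_descend (P := fun k => f y ∈ (filF k).map f)
    (fun k hk i hy => hinj k i _ hy (hmonoH hk hx)) m
    (AddSubgroup.mem_map_of_mem f (hmonoF le_add_self hm))
end

section
/- For every 0 ≤ j ≤ s−1: (i) Q_j lies in the ideal of R generated by S_0, …, S_j; (ii) Q_j − Σ_{k=0}^{j} T_k^{p^{j-k}} S_k lies in the ideal of R generated by the products S_k·S_l for 0 ≤ k, l ≤ j. -/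
/-!
Setting for the Witt-vector subtraction polynomials `Q_j` (Lemma 2.6/2.7 of the paper).
`R = ℤ[T_0, …, T_{s-1}, S_0, …, S_{s-1}]`, realized as
`MvPolynomial (Fin s ⊕ Fin s) ℤ` with `T k = X (Sum.inl k)` and `S k = X (Sum.inr k)`.
`Q j` is the `j`-th component (standard indexing) of the Witt-vector difference
`x' - x`, where `x` has components `T j` and `x'` has components `T j * (1 + S j)`.
-/

noncomputable section

open TruncatedWittVector MvPolynomial

variable (p : ℕ) [Fact p.Prime] (s : ℕ)

/-- `ℤ[T_0, …, T_{s-1}, S_0, …, S_{s-1}]`. -/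
abbrev Rpoly (s : ℕ) := MvPolynomial (Fin s ⊕ Fin s) ℤ

/-- The Witt vector `x = (T_j)_j` of length `s`. -/
def xWitt : TruncatedWittVector p s (Rpoly s) :=
  TruncatedWittVector.mk p fun j => X (Sum.inl j)

/-- The Witt vector `x' = (T_j (1 + S_j))_j` of length `s`. -/
def xWitt' : TruncatedWittVector p s (Rpoly s) :=
  TruncatedWittVector.mk p fun j => X (Sum.inl j) * (1 + X (Sum.inr j))

/-- The polynomial `Q_j`, the `j`-th component of the Witt-vector difference `x' - x`. -/
def Qpoly (j : Fin s) : Rpoly s := (xWitt' p s - xWitt p s).coeff j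

open Finset in
theorem WittVector.sum_pow_coeff_sub {A : Type*} [CommRing A] (x y : WittVector p A) (n : ℕ) :
    ∑ i ∈ range (n + 1), (p : A) ^ i * (x - y).coeff i ^ p ^ (n - i) =
      ∑ i ∈ range (n + 1),
        (p : A) ^ i * (x.coeff i ^ p ^ (n - i) - y.coeff i ^ p ^ (n - i)) := by
  have h := map_sub (WittVector.ghostComponent (p := p) (R := A) n) x y
  simpa only [WittVector.ghostComponent_apply, aeval_wittPolynomial, ← sum_sub_distrib,
    ← mul_sub] using h

theorem Ideal.one_add_pow_sub_mem_sq {A : Type*} [CommRing A] {I : Ideal A} {a : A}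
    (ha : a ∈ I) (n : ℕ) : (1 + a) ^ n - 1 - n * a ∈ I ^ 2 := by
  obtain ⟨k, hk⟩ := Polynomial.powAddExpansion 1 a n
  have h : (1 + a) ^ n - 1 - n * a = k * a ^ 2 := by rw [hk]; ring
  rw [h]
  exact (I ^ 2).mul_mem_left _ (Ideal.pow_mem_pow ha 2)

open Finset in
/-- If `I n ^ 2` has no `p`-torsion in its quotient, the `n`-th component of the difference of
the Witt vectors `(t k * (1 + a k))` and `(t k)` is linear in the `a k ∈ I n` up to `I n ^ 2`. -/
theorem WittVector.coeff_sub_sub_sum_mem_sq {A : Type*} [CommRing A] (I : ℕ → Ideal A)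
    (hI : Monotone I) (t a : ℕ → A) (ha : ∀ k, a k ∈ I k)
    (hsat : ∀ n (f : A), (p : A) ^ n * f ∈ I n ^ 2 → f ∈ I n ^ 2) (n : ℕ) :
    (WittVector.mk p (fun k => t k * (1 + a k)) - WittVector.mk p t).coeff n -
      ∑ k ∈ range (n + 1), t k ^ p ^ (n - k) * a k ∈ I n ^ 2 := by
  induction n using Nat.strong_induction_on with
  | _ n ih =>
    set d := WittVector.mk p (fun k => t k * (1 + a k)) - WittVector.mk p t with hd
    have hdI : ∀ k < n, d.coeff k ∈ I n := fun k hk => by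
      refine hI hk.le ?_
      rw [← sub_add_cancel (d.coeff k) (∑ i ∈ range (k + 1), t i ^ p ^ (k - i) * a i)]
      refine add_mem (Ideal.pow_le_self two_ne_zero (ih k hk)) (sum_mem fun i hi => ?_)
      exact Ideal.mul_mem_left _ _ (hI (by simpa [Nat.lt_succ_iff] using hi) (ha i))
    have hpow : ∀ k < n, d.coeff k ^ p ^ (n - k) ∈ I n ^ 2 := fun k hk =>
      Ideal.pow_le_pow_right
        ((Fact.out : p.Prime).two_le.trans (Nat.le_self_pow (by omega) p))
        (Ideal.pow_mem_pow (hdI k hk) _)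
    have hghost := WittVector.sum_pow_coeff_sub p
      (WittVector.mk p fun k => t k * (1 + a k)) (WittVector.mk p t) n
    rw [← hd, sum_range_succ] at hghost
    simp only [WittVector.coeff_mk, Nat.sub_self, pow_zero, pow_one] at hghost
    apply hsat
    have hlin : (p : A) ^ n * (d.coeff n - ∑ k ∈ range (n + 1), t k ^ p ^ (n - k) * a k) =
        ∑ k ∈ range (n + 1), (p : A) ^ k * t k ^ p ^ (n - k) *
          ((1 + a k) ^ p ^ (n - k) - 1 - (p ^ (n - k) : ℕ) * a k) -
        ∑ k ∈ range n, (p : A) ^ k * d.coeff k ^ p ^ (n - k) := by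
      rw [mul_sub, eq_sub_of_add_eq' hghost, mul_sum, sub_right_comm, ← sum_sub_distrib]
      congr 1
      refine sum_congr rfl fun k hk => ?_
      have hp : (p : A) ^ n = (p : A) ^ k * (p : A) ^ (n - k) := by
        rw [← pow_add, Nat.add_sub_cancel' (by simpa [Nat.lt_succ_iff] using hk)]
      rw [hp, mul_pow]
      push_cast
      ring
    rw [hlin]
    refine sub_mem (sum_mem fun k hk => ?_) (sum_mem fun k hk => ?_)
    · exact Ideal.mul_mem_left _ _ (Ideal.one_add_pow_sub_mem_sq
        (hI (by simpa [Nat.lt_succ_iff] using hk) (ha k)) _)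
    · exact Ideal.mul_mem_left _ _ (hpow k (by simpa using hk))

theorem MvPolynomial.span_X_image_sq {σ A : Type*} [CommRing A] (U : Set σ) :
    Ideal.span ((X : σ → MvPolynomial σ A) '' U) ^ 2 =
      Ideal.span ((fun m => monomial m (1 : A)) ''
        Set.image2 (fun i j => Finsupp.single i 1 + Finsupp.single j 1) U U) := by
  rw [sq, Ideal.span_mul_span', ← Set.image2_mul, Set.image2_image_left,
    Set.image2_image_right, Set.image_image2]
  congr 2
  ext i j
  simp [X, monomial_mul]

theorem MvPolynomial.mem_span_X_image_sq_of_C_mul_mem {σ A : Type*} [CommRing A] [IsDomain A]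
    {U : Set σ} {c : A} (hc : c ≠ 0) {f : MvPolynomial σ A}
    (h : C c * f ∈ Ideal.span ((X : σ → MvPolynomial σ A) '' U) ^ 2) :
    f ∈ Ideal.span ((X : σ → MvPolynomial σ A) '' U) ^ 2 := by
  rw [span_X_image_sq, mem_ideal_span_monomial_image] at h ⊢
  intro m hm
  refine h m ?_
  rw [mem_support_iff] at hm ⊢
  rw [coeff_C_mul]
  exact mul_ne_zero hc hm

theorem TruncatedWittVector.coeff_mk_sub_mk {A : Type*} [CommRing A] (x y : ℕ → A) (j : Fin s) :
    (TruncatedWittVector.mk p (fun i : Fin s => x i) -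
      TruncatedWittVector.mk p (fun i : Fin s => y i)).coeff j =
      (WittVector.mk p x - WittVector.mk p y).coeff j := by
  have h : ∀ z : ℕ → A, TruncatedWittVector.mk p (fun i : Fin s => z i) =
      WittVector.truncate s (WittVector.mk p z) := fun z => by
    ext i
    simp [WittVector.coeff_truncate]
  rw [h, h, ← map_sub, WittVector.coeff_truncate]

/-- The variable `X (e k)`, extended by zero to all natural numbers `k`. -/
def extendedVar (e : Fin s → Fin s ⊕ Fin s) (k : ℕ) : Rpoly s :=
  if h : k < s then X (e ⟨k, h⟩) else 0

@[simp]
theorem extendedVar_val (e : Fin s → Fin s ⊕ Fin s) (k : Fin s) :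
    extendedVar s e k = X (e k) := by
  simp [extendedVar]

theorem Qpoly_sub_sum_mem_sq (j : Fin s) :
    Qpoly p s j -
        ∑ k ∈ Finset.univ.filter (fun k : Fin s => (k : ℕ) ≤ (j : ℕ)),
          (X (Sum.inl k) : Rpoly s) ^ (p ^ ((j : ℕ) - (k : ℕ))) * X (Sum.inr k)
      ∈ Ideal.span ((X : _ → Rpoly s) '' (Sum.inr '' {k : Fin s | (k : ℕ) ≤ j})) ^ 2 := by
  have key := WittVector.coeff_sub_sub_sum_mem_sq p
    (fun n => Ideal.span ((X : _ → Rpoly s) '' (Sum.inr '' {k : Fin s | (k : ℕ) ≤ n})))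
    (fun m n hmn => Ideal.span_mono (Set.image_mono (Set.image_mono fun k hk => hk.trans hmn)))
    (extendedVar s Sum.inl) (extendedVar s Sum.inr)
    (fun k => by
      unfold extendedVar
      split_ifs with h
      · exact Ideal.subset_span ⟨_, ⟨⟨k, h⟩, le_refl k, rfl⟩, rfl⟩
      · exact zero_mem _)
    (fun n f hf => by
      refine mem_span_X_image_sq_of_C_mul_mem (c := (p : ℤ) ^ n) ?_ (by simpa using hf)
      exact pow_ne_zero _ (Nat.cast_ne_zero.mpr (Fact.out : p.Prime).ne_zero))
    j
  rw [← TruncatedWittVector.coeff_mk_sub_mk] at key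
  simp only [extendedVar_val] at key
  have hsum : ∑ k ∈ Finset.univ.filter (fun k : Fin s => (k : ℕ) ≤ (j : ℕ)),
      (X (Sum.inl k) : Rpoly s) ^ (p ^ ((j : ℕ) - (k : ℕ))) * X (Sum.inr k) =
      ∑ k ∈ Finset.range ((j : ℕ) + 1),
        extendedVar s Sum.inl k ^ p ^ ((j : ℕ) - k) * extendedVar s Sum.inr k := by
    refine Finset.sum_bij (fun k _ => (k : ℕ)) (fun k hk => ?_) (fun k _ l _ h => Fin.ext h)
      (fun k hk => ?_) (fun k _ => by simp)
    · simpa [Nat.lt_succ_iff] using hk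
    · have hk' : k ≤ j := by simpa [Nat.lt_succ_iff] using hk
      exact ⟨⟨k, hk'.trans_lt j.2⟩, Finset.mem_filter.mpr ⟨Finset.mem_univ _, hk'⟩, rfl⟩
  rw [hsum]
  exact key

/-- Lemma 2.6 (i), (ii) of the paper.  For every `0 ≤ j ≤ s - 1`:
(i) `Q_j` lies in the ideal of `R` generated by `S_0, …, S_j`;
(ii) `Q_j - ∑_{k ≤ j} T_k^{p^{j-k}} S_k` lies in the ideal of `R` generated by the
products `S_k · S_l` for `0 ≤ k, l ≤ j`. -/
theorem statement16 (j : Fin s) :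
    (Qpoly p s j ∈
        Ideal.span {q : Rpoly s | ∃ k : Fin s, (k : ℕ) ≤ (j : ℕ) ∧ q = X (Sum.inr k)}) ∧
    (Qpoly p s j -
        ∑ k ∈ Finset.univ.filter (fun k : Fin s => (k : ℕ) ≤ (j : ℕ)),
          (X (Sum.inl k) : Rpoly s) ^ (p ^ ((j : ℕ) - (k : ℕ))) * X (Sum.inr k)
      ∈ Ideal.span {q : Rpoly s | ∃ k l : Fin s,
          (k : ℕ) ≤ (j : ℕ) ∧ (l : ℕ) ≤ (j : ℕ) ∧ q = X (Sum.inr k) * X (Sum.inr l)}) := by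
  have hI : {q : Rpoly s | ∃ k : Fin s, (k : ℕ) ≤ (j : ℕ) ∧ q = X (Sum.inr k)} =
      X '' (Sum.inr '' {k : Fin s | (k : ℕ) ≤ j}) := by
    ext q
    simp [eq_comm]
  have hJ : Ideal.span {q : Rpoly s | ∃ k l : Fin s,
      (k : ℕ) ≤ (j : ℕ) ∧ (l : ℕ) ≤ (j : ℕ) ∧ q = X (Sum.inr k) * X (Sum.inr l)} =
      Ideal.span (X '' (Sum.inr '' {k : Fin s | (k : ℕ) ≤ j})) ^ 2 := by
    rw [sq, Ideal.span_mul_span', ← hI]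
    congr 1
    ext q
    simp only [Set.mem_mul, Set.mem_ofPred_eq]
    constructor
    · rintro ⟨k, l, hk, hl, rfl⟩
      exact ⟨_, ⟨k, hk, rfl⟩, _, ⟨l, hl, rfl⟩, rfl⟩
    · rintro ⟨_, ⟨k, hk, rfl⟩, _, ⟨l, hl, rfl⟩, rfl⟩
      exact ⟨k, l, hk, hl, rfl⟩
  have key := Qpoly_sub_sum_mem_sq p s j
  refine ⟨?_, hJ ▸ key⟩
  rw [← hI] at key
  refine (Submodule.sub_mem_iff_left _ (sum_mem fun k hk => ?_)).mp
    (Ideal.pow_le_self two_ne_zero key)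
  exact Ideal.mul_mem_left _ _ (Ideal.subset_span ⟨k, (Finset.mem_filter.mp hk).2, rfl⟩)
end
end
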